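/- arXiv:1802.09340 — 2 statements merged into one kernel-verified Lean document; each statement's English description precedes it below -/
import Mathlib

section
/- There exists a magic knight's tour of the 4×26 board: a knight's tour in which each of the four 26-cell rows sums to 1365 and each of the twenty-six 4-cell columns sums to 210. -/
/-- Two cells are a knight's move apart: coordinate differences in absolute
value are {1,2}. -/
def knightMove {m n : ℕ} (a b : Fin m × Fin n) : Prop :=
  (((a.1.val : ℤ) - b.1.val).natAbs = 1 ∧ ((a.2.val : ℤ) - b.2.val).natAbs = 2) ∨
  (((a.1.val : ℤ) - b.1.val).natAbs = 2 ∧ ((a.2.val : ℤ) - b.2.val).natAbs = 1)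

/-- A knight's tour of the m×n board: a bijective numbering (as an equiv from
`Fin (m*n)`, representing the numbers 1,…,m·n) of the cells, such that
consecutive numbers occupy cells a knight's move apart. -/
def IsKnightTour (m n : ℕ) (t : Fin (m * n) ≃ Fin m × Fin n) : Prop :=
  ∀ (k : ℕ) (h : k + 1 < m * n),
    knightMove (t ⟨k, Nat.lt_of_succ_lt h⟩) (t ⟨k + 1, h⟩)

/-- The number (in 1,…,m·n) assigned to a cell by the tour. -/
def cellNum {m n : ℕ} (t : Fin (m * n) ≃ Fin m × Fin n) (c : Fin m × Fin n) : ℕ :=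
  (t.symm c).val + 1

/-- The sum of the numbers in row `i` (an n-cell line). -/
def rowSum {m n : ℕ} (t : Fin (m * n) ≃ Fin m × Fin n) (i : Fin m) : ℕ :=
  ∑ j : Fin n, cellNum t (i, j)

/-- The sum of the numbers in column `j` (an m-cell line). -/
def colSum {m n : ℕ} (t : Fin (m * n) ≃ Fin m × Fin n) (j : Fin n) : ℕ :=
  ∑ i : Fin m, cellNum t (i, j)

/-- The cells of a magic knight's tour of the 4×26 board, in order of visit. -/
def magicTourCell : Fin (4 * 26) → Fin 4 × Fin 26 :=
  ![(3, 3), (2, 1), (0, 0), (1, 2), (0, 4), (1, 6), (3, 7), (2, 5),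
    (0, 6), (1, 8), (3, 9), (1, 10), (3, 11), (2, 13), (0, 14), (2, 15),
    (0, 16), (1, 18), (3, 17), (2, 19), (0, 20), (2, 21), (3, 23), (2, 25),
    (0, 24), (1, 22), (3, 21), (2, 23), (3, 25), (1, 24), (0, 22), (1, 20),
    (3, 19), (2, 17), (0, 18), (1, 16), (3, 15), (1, 14), (0, 12), (2, 11),
    (3, 13), (1, 12), (0, 10), (2, 9), (0, 8), (2, 7), (3, 5), (1, 4),
    (0, 2), (1, 0), (3, 1), (2, 3), (1, 1), (3, 0), (2, 2), (0, 3),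
    (2, 4), (0, 5), (1, 7), (3, 8), (1, 9), (3, 10), (2, 12), (0, 13),
    (1, 11), (3, 12), (2, 14), (0, 15), (2, 16), (3, 18), (1, 17), (0, 19),
    (2, 20), (3, 22), (2, 24), (0, 25), (1, 23), (0, 21), (2, 22), (3, 24),
    (1, 25), (0, 23), (1, 21), (3, 20), (1, 19), (0, 17), (2, 18), (3, 16),
    (1, 15), (3, 14), (1, 13), (0, 11), (2, 10), (0, 9), (2, 8), (3, 6),
    (1, 5), (0, 7), (2, 6), (3, 4), (1, 3), (3, 2), (2, 0), (0, 1)]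

/-- The time, counted from 0, at which `magicTourCell` visits the cell in row `i` and column `j`. -/
def magicTourTime : Fin 4 → Fin 26 → Fin (4 * 26) :=
  ![![2, 103, 48, 55, 4, 57, 8, 97, 44, 93, 42, 91, 38, 63, 14, 67, 16, 85, 34, 71, 20, 77, 30, 81, 24, 75],
    ![49, 52, 3, 100, 47, 96, 5, 58, 9, 60, 11, 64, 41, 90, 37, 88, 35, 70, 17, 84, 31, 82, 25, 76, 29, 80],
    ![102, 1, 54, 51, 56, 7, 98, 45, 94, 43, 92, 39, 62, 13, 66, 15, 68, 33, 86, 19, 72, 21, 78, 27, 74, 23],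
    ![53, 50, 101, 0, 99, 46, 95, 6, 59, 10, 61, 12, 65, 40, 89, 36, 87, 18, 69, 32, 83, 26, 73, 22, 79, 28]]

/-- The numbering of the 4×26 board given by `magicTourCell`. -/
def magicTour : Fin (4 * 26) ≃ Fin 4 × Fin 26 where
  toFun := magicTourCell
  invFun c := magicTourTime c.1 c.2
  left_inv := by decide +kernel
  right_inv := by decide +kernel

instance {m n : ℕ} (a b : Fin m × Fin n) : Decidable (knightMove a b) :=
  inferInstanceAs (Decidable (_ ∨ _))

theorem isKnightTour_magicTour : IsKnightTour 4 26 magicTour := by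
  have step : ∀ k : Fin 103, knightMove (magicTour ⟨k, by omega⟩) (magicTour ⟨k + 1, by omega⟩) := by
    decide +kernel
  exact fun k h => step ⟨k, by omega⟩

theorem rowSum_magicTour : ∀ i, rowSum magicTour i = 1365 := by
  decide +kernel

theorem colSum_magicTour : ∀ j, colSum magicTour j = 210 := by
  decide +kernel

/-- There exists a magic knight's tour of the 4×26 board. -/
theorem magic_tour_4x26 :
    ∃ t : Fin (4 * 26) ≃ Fin 4 × Fin 26, IsKnightTour 4 26 t ∧
      (∀ i : Fin 4, rowSum t i = 1365) ∧ (∀ j : Fin 26, colSum t j = 210) := by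
  exact ⟨magicTour, isKnightTour_magicTour, rowSum_magicTour, colSum_magicTour⟩
end

section
/- There exists a quasi-magic knight's tour of the 4×14 board with the 14-cell lines magic: a knight's tour in which each of the four 14-cell lines sums to the magic constant 399, and the fourteen 4-cell lines take exactly two distinct sum values. -/
/-- The cells of a 4×14 knight's tour, in the order in which they are visited. -/
def tourCell : Fin (4 * 14) → Fin 4 × Fin 14 :=
  ![(0, 2), (1, 0), (3, 1), (1, 2), (0, 0), (2, 1), (3, 3), (2, 5),
    (0, 4), (1, 6), (0, 8), (2, 7), (3, 9), (1, 10), (3, 11), (2, 13),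
    (0, 12), (2, 11), (3, 13), (1, 12), (0, 10), (2, 9), (3, 7), (1, 8),
    (0, 6), (1, 4), (3, 5), (2, 3), (1, 1), (3, 0), (2, 2), (0, 1),
    (2, 0), (3, 2), (1, 3), (3, 4), (2, 6), (0, 5), (1, 7), (0, 9),
    (2, 8), (3, 10), (2, 12), (0, 13), (1, 11), (3, 12), (1, 13), (0, 11),
    (2, 10), (3, 8), (1, 9), (0, 7), (1, 5), (3, 6), (2, 4), (0, 3)]

/-- The index in `tourCell` of each cell of the board, row by row. -/
def tourIndex : Fin 4 → Fin 14 → Fin (4 * 14) :=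
  ![![4, 31, 0, 55, 8, 37, 24, 51, 10, 39, 20, 47, 16, 43],
    ![1, 28, 3, 34, 25, 52, 9, 38, 23, 50, 13, 44, 19, 46],
    ![32, 5, 30, 27, 54, 7, 36, 11, 40, 21, 48, 17, 42, 15],
    ![29, 2, 33, 6, 35, 26, 53, 22, 49, 12, 41, 14, 45, 18]]

/-- The numbering of the 4×14 board given by `tourCell`. -/
def quasiMagicTour : Fin (4 * 14) ≃ Fin 4 × Fin 14 where
  toFun := tourCell
  invFun c := tourIndex c.1 c.2
  left_inv := by decide +kernel
  right_inv := by decide +kernel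

theorem isKnightTour_quasiMagicTour : IsKnightTour 4 14 quasiMagicTour := by
  have h : ∀ k : Fin 55, knightMove (quasiMagicTour k.castSucc) (quasiMagicTour k.succ) := by
    unfold knightMove
    decide +kernel
  exact fun k hk => h ⟨k, by omega⟩

theorem rowSum_quasiMagicTour : ∀ i, rowSum quasiMagicTour i = 399 := by
  decide +kernel

theorem colSum_quasiMagicTour :
    ∀ j, colSum quasiMagicTour j = 70 ∨ colSum quasiMagicTour j = 126 := by
  decide +kernel

/-- There exists a quasi-magic knight's tour of the 4×14 board: every
14-cell line (row) sums to the magic constant 399, and the 4-cell lines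
(columns) take exactly two distinct sum values. -/
theorem quasi_magic_4x14_rows :
    ∃ t : Fin (4 * 14) ≃ Fin 4 × Fin 14, IsKnightTour 4 14 t ∧
      (∀ i : Fin 4, rowSum t i = 399) ∧
      ∃ a b : ℕ, a ≠ b ∧ (∀ j : Fin 14, colSum t j = a ∨ colSum t j = b) ∧
        (∃ j : Fin 14, colSum t j = a) ∧ (∃ j : Fin 14, colSum t j = b) := by
  exact ⟨quasiMagicTour, isKnightTour_quasiMagicTour, rowSum_quasiMagicTour, 70, 126, by decide,
    colSum_quasiMagicTour, ⟨0, by decide +kernel⟩, ⟨13, by decide +kernel⟩⟩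
end
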